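/- Product rule in B^0_{∞,1} with div-curl structure: There exists an absolute constant C > 0 such that for vector fields u, v on 𝕋^d with div u = 0, ‖u·∇v‖_{B^0_{∞,1}} ≤ C ‖u‖_{B^0_{∞,1}} ‖v‖_{B^1_{∞,1}}. -/

import Mathlib

open MeasureTheory Complex
open scoped BigOperators ENNReal NNReal

noncomputable section

/-! ## A Fourier-analytic framework for distributions on the torus `𝕋^d`

A distribution on `𝕋^d` is represented by its sequence of Fourier coefficients,
a function `(Fin d → ℤ) → E` (with `E = ℂ` for scalar functions, `E = Fin d → ℂ`
for vector fields, etc.).  All operators (Littlewood–Paley blocks, Leray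
projection, advection, Laplacian, ...) are defined on the Fourier side, and `L^p`
norms are computed from the realization as a (periodic) function on the cube. -/

/-- Euclidean norm of a lattice frequency. -/
def znorm {d : ℕ} (k : Fin d → ℤ) : ℝ := Real.sqrt (∑ i, ((k i : ℝ)) ^ 2)

/-- Squared Euclidean norm of a lattice frequency. -/
def znorm2 {d : ℕ} (k : Fin d → ℤ) : ℤ := ∑ i, (k i) ^ 2

/-- The character `e^{2πik·x}`. -/
def fChar {d : ℕ} (k : Fin d → ℤ) (x : Fin d → ℝ) : ℂ :=
  Complex.exp (((2 * Real.pi * ∑ i, (k i : ℝ) * x i : ℝ) : ℂ) * Complex.I)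

variable {d : ℕ} {E : Type*}

/-- Realization of a Fourier coefficient sequence as a (periodic) function on `ℝ^d`. -/
def realize [NormedAddCommGroup E] [NormedSpace ℂ E] (a : (Fin d → ℤ) → E) :
    (Fin d → ℝ) → E :=
  fun x => ∑' k, fChar k x • a k

/-- The fundamental cube of the torus, as a measure on `ℝ^d`. -/
def μT (d : ℕ) : Measure (Fin d → ℝ) := volume.restrict (Set.Icc 0 1)

/-- The `L^p` norm over the torus of (the realization of) a coefficient sequence. -/
def tLp [NormedAddCommGroup E] [NormedSpace ℂ E] (p : ℝ≥0∞) (a : (Fin d → ℤ) → E) :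
    ℝ≥0∞ :=
  eLpNorm (realize a) p (μT d)

/-- A smooth monotone Littlewood–Paley cutoff function `χ` as in the paper:
`χ : [0,∞) → [0,1]`, `χ ≡ 1` on `[0,1/2]`, `χ(3/4) = 1/2`, `χ ≡ 0` on `[1,∞)`. -/
structure Cutoff where
  χ : ℝ → ℝ
  smooth : ContDiff ℝ (⊤ : ℕ∞) χ
  mono : AntitoneOn χ (Set.Ici 0)
  nonneg : ∀ x, 0 ≤ χ x
  le_one : ∀ x, χ x ≤ 1
  eq_one : ∀ x ∈ Set.Icc (0 : ℝ) (1 / 2), χ x = 1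
  eq_half : χ (3 / 4) = 1 / 2
  eq_zero : ∀ x, (1 : ℝ) ≤ x → χ x = 0

/-- The symbol of the Littlewood–Paley block `Δ_j`:
`χ(t)` for `j = 0` and `φ(t/2^j) = χ(t/2^j) − χ(t/2^{j-1})` for `j ≥ 1`. -/
def lpSymb (c : Cutoff) : ℕ → ℝ → ℝ
  | 0, t => c.χ t
  | j + 1, t => c.χ (t / 2 ^ (j + 1)) - c.χ (t / 2 ^ j)

/-- The Littlewood–Paley block `Δ_j`, acting on Fourier coefficients. -/
def blockC [NormedAddCommGroup E] [NormedSpace ℂ E] (c : Cutoff) (j : ℕ)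
    (a : (Fin d → ℤ) → E) : (Fin d → ℤ) → E :=
  fun k => ((lpSymb c j (znorm k) : ℝ) : ℂ) • a k

/-- The low-frequency cutoff `S_j = Δ_0 + Δ_1 + ⋯ + Δ_j`, acting on Fourier coefficients. -/
def lowC [NormedAddCommGroup E] [NormedSpace ℂ E] (c : Cutoff) (j : ℕ)
    (a : (Fin d → ℤ) → E) : (Fin d → ℤ) → E :=
  fun k => ((∑ l ∈ Finset.range (j + 1), lpSymb c l (znorm k) : ℝ) : ℂ) • a k

/-- The `ℓ^r` norm (`r ∈ [1,∞]`) of a sequence of extended nonnegative reals. -/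
def lr (r : ℝ≥0∞) (a : ℕ → ℝ≥0∞) : ℝ≥0∞ :=
  if r = ∞ then ⨆ j, a j else (∑' j, a j ^ r.toReal) ^ (1 / r.toReal)

/-- The inhomogeneous Besov norm `‖·‖_{B^s_{p,r}}` on the torus:
the `ℓ^r` norm of `j ↦ 2^{js} ‖Δ_j a‖_{L^p}`. -/
def besov [NormedAddCommGroup E] [NormedSpace ℂ E] (c : Cutoff) (s : ℝ) (p r : ℝ≥0∞)
    (a : (Fin d → ℤ) → E) : ℝ≥0∞ :=
  lr r fun j => (2 : ℝ≥0∞) ^ ((j : ℝ) * s) * tLp p (blockC c j a)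

/-- Rapid decay of Fourier coefficients: the represented distribution is smooth. -/
def SmoothCoeff [NormedAddCommGroup E] (a : (Fin d → ℤ) → E) : Prop :=
  ∀ n : ℕ, ∃ C : ℝ, ∀ k, ‖a k‖ * (1 + znorm k) ^ n ≤ C

/-- The Fourier multiplier `Λ^s = (-Δ)^{s/2}` with symbol `|k|^s`. -/
def lambdaPow [NormedAddCommGroup E] [NormedSpace ℂ E] (s : ℝ) (a : (Fin d → ℤ) → E) :
    (Fin d → ℤ) → E :=
  fun k => ((znorm k ^ s : ℝ) : ℂ) • a k

/-- Fourier coefficients of the pointwise product of a scalar function with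
coefficients `a` and an `E`-valued function with coefficients `b` (convolution). -/
def convC [NormedAddCommGroup E] [NormedSpace ℂ E] (a : (Fin d → ℤ) → ℂ)
    (b : (Fin d → ℤ) → E) : (Fin d → ℤ) → E :=
  fun k => ∑' m, a m • b (k - m)

/-- The Bony paraproduct `T_u v = Σ_{j≥1} S_{j−1}u Δ_j v`, on Fourier coefficients. -/
def para (c : Cutoff) (u v : (Fin d → ℤ) → ℂ) : (Fin d → ℤ) → ℂ :=
  fun k => ∑' j : ℕ, convC (lowC c j u) (blockC c (j + 1) v) k

/-- The Bony remainder `R(u,v) = Σ_{|j−l|≤1} Δ_j u Δ_l v`, on Fourier coefficients. -/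
def remainder (c : Cutoff) (u v : (Fin d → ℤ) → ℂ) : (Fin d → ℤ) → ℂ :=
  fun k => ∑' j : ℕ, ∑' l : ℕ,
    if ((j : ℤ) - l).natAbs ≤ 1 then convC (blockC c j u) (blockC c l v) k else 0

/-- Fourier coefficients of a vector field on `𝕋^d`. -/
abbrev VC (d : ℕ) := (Fin d → ℤ) → Fin d → ℂ

/-- The divergence-free condition `∇·u = 0`, on Fourier coefficients. -/
def DivFree {d : ℕ} (u : VC d) : Prop := ∀ k, ∑ i, (k i : ℂ) * u k i = 0

/-- Fourier coefficients of the advection term `u·∇v = Σ_l u_l ∂_l v`. -/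
def advect {d : ℕ} (u v : VC d) : VC d :=
  fun k i => ∑' m : Fin d → ℤ,
    (∑ l, u m l * (((2 * Real.pi : ℝ) : ℂ) * Complex.I * ((k l - m l : ℤ) : ℂ)))
      * v (k - m) i

/-- The Leray projection `ℙ` onto divergence-free fields, on Fourier coefficients. -/
def leray {d : ℕ} (v : VC d) : VC d :=
  fun k i => if k = 0 then v k i
    else v k i - ((∑ l, (k l : ℂ) * v k l) / ((znorm2 k : ℤ) : ℂ)) * (k i : ℂ)

/-- Fourier coefficients of the Laplacian `Δ`. -/
def lapC [NormedAddCommGroup E] [NormedSpace ℂ E] (a : (Fin d → ℤ) → E) :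
    (Fin d → ℤ) → E :=
  fun k => ((-(4 * Real.pi ^ 2 * ((znorm2 k : ℤ) : ℝ)) : ℝ) : ℂ) • a k

/-- Fourier coefficients of the gradient `∇q` of a scalar function. -/
def gradC {d : ℕ} (q : (Fin d → ℤ) → ℂ) : VC d :=
  fun k i => ((2 * Real.pi : ℝ) : ℂ) * Complex.I * ((k i : ℤ) : ℂ) * q k

/-- Fourier coefficients of the full gradient `∇u` (a matrix field) of a vector field. -/
def gradM {d : ℕ} (u : VC d) : (Fin d → ℤ) → Fin d → Fin d → ℂ :=
  fun k i l => ((2 * Real.pi : ℝ) : ℂ) * Complex.I * ((k l : ℤ) : ℂ) * u k i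

/-- Fourier coefficients of the divergence `∇·w` of a vector field. -/
def divC {d : ℕ} (w : VC d) : (Fin d → ℤ) → ℂ :=
  fun k => ((2 * Real.pi : ℝ) : ℂ) * Complex.I * ∑ l, (k l : ℂ) * w k l

/-- The inverse `(−Δ)^{−1}` of the negative Laplacian on mean-zero functions. -/
def invNegLap [NormedAddCommGroup E] [NormedSpace ℂ E] (a : (Fin d → ℤ) → E) :
    (Fin d → ℤ) → E :=
  fun k => if k = 0 then 0 else (((4 * Real.pi ^ 2 * ((znorm2 k : ℤ) : ℝ))⁻¹ : ℝ) : ℂ) • a k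

/-- The commutator `I_j = [u·∇, ℙΔ_j] f = u·∇(ℙΔ_j f) − ℙΔ_j (u·∇ f)`. -/
def commJ {d : ℕ} (c : Cutoff) (u f : VC d) (j : ℕ) : VC d :=
  fun k i => advect u (leray (blockC c j f)) k i - leray (blockC c j (advect u f)) k i

/-- `U` (with pressure `P`) solves the incompressible Navier–Stokes equations
`∂_t u + u·∇u + ∇p = νΔu`, `∇·u = 0` on the time interval `[0,T]`, on the Fourier side. -/
def SolvesNS (ν T : ℝ) (U : ℝ → VC 2) (P : ℝ → (Fin 2 → ℤ) → ℂ) : Prop :=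
  (∀ t ∈ Set.Icc (0 : ℝ) T, DivFree (U t)) ∧
  ∀ t ∈ Set.Icc (0 : ℝ) T, ∀ k i,
    HasDerivAt (fun s => U s k i)
      ((ν : ℂ) * lapC (U t) k i - advect (U t) (U t) k i - gradC (P t) k i) t

/-- One step of the semi-implicit scheme
`(u^{n+1} − u^n)/τ + ℙ(u^n·∇u^{n+1}) = νΔu^{n+1}`. -/
def SchemeStep (ν τ : ℝ) (v w : VC 2) : Prop :=
  ∀ k i, (w k i - v k i) / (τ : ℂ) + leray (advect v w) k i = (ν : ℂ) * lapC w k i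

open scoped Classical in
/-- The Fourier truncation `Π_N`, keeping only the frequencies with `1 ≤ |k|_∞ ≤ N`. -/
def truncC {d : ℕ} (N : ℕ) (v : VC d) : VC d :=
  fun k i => if (∀ l, |k l| ≤ (N : ℤ)) ∧ k ≠ 0 then v k i else 0

/-- One step of the fully discrete Fourier spectral semi-implicit scheme
`(u^{n+1} − u^n)/τ + ℙΠ_N(u^n·∇u^{n+1}) = νΔu^{n+1}`. -/
def SchemeStepN (N : ℕ) (ν τ : ℝ) (v w : VC 2) : Prop :=
  ∀ k i, (w k i - v k i) / (τ : ℂ) + leray (truncC N (advect v w)) k i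
    = (ν : ℂ) * lapC w k i


open Function FourierTransform SchwartzMap

lemma fChar_eq_mFourier (k : Fin d → ℤ) (x : Fin d → ℝ) :
    fChar k x = UnitAddTorus.mFourier k (fun i => (x i : UnitAddCircle)) := by
  simp only [fChar, UnitAddTorus.mFourier, ContinuousMap.coe_mk, fourier_coe_apply]
  rw [← Complex.exp_sum]
  congr 1
  push_cast
  rw [Finset.mul_sum, Finset.sum_mul]
  refine Finset.sum_congr rfl fun i _ => ?_
  ring

lemma fChar_add_freq (k m : Fin d → ℤ) (x : Fin d → ℝ) :
    fChar (k + m) x = fChar k x * fChar m x := by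
  simp only [fChar_eq_mFourier, UnitAddTorus.mFourier_add]

lemma norm_fChar (k : Fin d → ℤ) (x : Fin d → ℝ) : ‖fChar k x‖ = 1 := by
  rw [fChar, Complex.norm_exp_ofReal_mul_I]

lemma fChar_fract (k : Fin d → ℤ) (x : Fin d → ℝ) :
    fChar k (fun i => Int.fract (x i)) = fChar k x := by
  simp only [fChar_eq_mFourier]
  congr 1
  funext i
  rw [← sub_eq_zero, ← AddCircle.coe_sub, AddCircle.coe_eq_zero_iff]
  exact ⟨-⌊x i⌋, by
    have := Int.floor_add_fract (x i)
    simp only [zsmul_eq_mul, Int.cast_neg, mul_one]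
    linarith⟩

lemma continuous_fChar (k : Fin d → ℤ) : Continuous (fChar k) := by
  unfold fChar
  fun_prop

section Realize

variable [NormedAddCommGroup E] [NormedSpace ℂ E]

lemma realize_eq_sum {a : (Fin d → ℤ) → E} {s : Finset (Fin d → ℤ)} (h : support a ⊆ s)
    (x : Fin d → ℝ) : realize a x = ∑ k ∈ s, fChar k x • a k := by
  refine tsum_eq_sum fun k hk => ?_
  rw [notMem_support.1 fun hk' => hk (h hk'), smul_zero]

lemma continuous_realize {a : (Fin d → ℤ) → E} (h : (support a).Finite) :
    Continuous (realize a) := by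
  have : realize a = fun x => ∑ k ∈ h.toFinset, fChar k x • a k :=
    funext fun x => realize_eq_sum (by simp) x
  rw [this]
  exact continuous_finsetSum _ fun k _ => (continuous_fChar k).smul continuous_const

lemma realize_fract (a : (Fin d → ℤ) → E) (x : Fin d → ℝ) :
    realize a (fun i => Int.fract (x i)) = realize a x := by
  simp only [realize, fChar_fract]

lemma enorm_realize_le_tLp {a : (Fin d → ℤ) → E} (h : (support a).Finite) (x : Fin d → ℝ) :
    ‖realize a x‖ₑ ≤ tLp ∞ a := by
  by_contra! hx
  set U : Set (Fin d → ℝ) := {y | tLp ∞ a < ‖realize a y‖ₑ} with hU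
  have hUo : IsOpen U := isOpen_lt continuous_const (continuous_realize h).enorm
  have hy : (fun i => Int.fract (x i)) ∈ U := by
    simpa only [hU, Set.mem_ofPred_eq, realize_fract] using hx
  have hycl : (fun i => Int.fract (x i)) ∈ closure (interior (Set.Icc (0 : Fin d → ℝ) 1)) := by
    rw [← Set.pi_univ_Icc, interior_pi_set Set.finite_univ, closure_pi_set]
    intro i _
    simpa using Set.mem_Icc.2 ⟨Int.fract_nonneg (x i), (Int.fract_lt_one (x i)).le⟩
  obtain ⟨z, hz⟩ := mem_closure_iff.1 hycl U hUo hy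
  have hpos : 0 < volume (U ∩ interior (Set.Icc (0 : Fin d → ℝ) 1)) :=
    (hUo.inter isOpen_interior).measure_pos _ ⟨z, hz⟩
  have hzero : μT d U = 0 := by
    have : ∀ᵐ y ∂μT d, ‖realize a y‖ₑ ≤ tLp ∞ a := by
      rw [tLp, eLpNorm_exponent_top]
      exact enorm_ae_le_eLpNormEssSup _ _
    simpa [ae_iff, hU] using this
  rw [μT, Measure.restrict_apply hUo.measurableSet] at hzero
  exact hpos.ne' (measure_mono_null (Set.inter_subset_inter_right _ interior_subset) hzero)

lemma tLp_top_le {a : (Fin d → ℤ) → E} {B : ℝ≥0∞} (h : ∀ x, ‖realize a x‖ₑ ≤ B) :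
    tLp ∞ a ≤ B := by
  rw [tLp, eLpNorm_exponent_top]
  exact essSup_le_of_ae_le _ (Filter.Eventually.of_forall h)

end Realize

section Bessel

local instance : MeasureSpace UnitAddCircle := ⟨AddCircle.haarAddCircle⟩

local instance : IsProbabilityMeasure (volume : Measure UnitAddCircle) :=
  inferInstanceAs (IsProbabilityMeasure AddCircle.haarAddCircle)

lemma sum_sq_le_of_norm_realize_le {a : (Fin d → ℤ) → ℂ} {s : Finset (Fin d → ℤ)}
    (h : support a ⊆ s) {B : ℝ} (hB : ∀ x, ‖realize a x‖ ≤ B) :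
    ∑ k ∈ s, ‖a k‖ ^ 2 ≤ B ^ 2 := by
  have hB0 : 0 ≤ B := (norm_nonneg _).trans (hB 0)
  set f : C(UnitAddTorus (Fin d), ℂ) := ∑ k ∈ s, a k • UnitAddTorus.mFourier k with hf
  have hfB : ‖f‖ ≤ B := by
    refine (ContinuousMap.norm_le _ hB0).2 fun y => ?_
    choose x hx using fun i => QuotientAddGroup.mk_surjective (y i)
    have hy : y = fun i => (x i : UnitAddCircle) := funext fun i => (hx i).symm
    have : f y = realize a x := by
      rw [realize_eq_sum h, hf, hy]
      simp [fChar_eq_mFourier, mul_comm]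
    rw [this]
    exact hB x
  have hL2 : ‖ContinuousMap.toLp (E := ℂ) 2 volume ℂ f‖ ^ 2 = ∑ k ∈ s, ‖a k‖ ^ 2 := by
    have : ContinuousMap.toLp (E := ℂ) 2 volume ℂ f
        = ∑ k ∈ s, a k • UnitAddTorus.mFourierLp 2 k := by
      simp [hf, map_sum, UnitAddTorus.mFourierLp]
    rw [this, ← RCLike.ofReal_inj (K := ℂ), RCLike.ofReal_pow, ← inner_self_eq_norm_sq_to_K,
      UnitAddTorus.orthonormal_mFourier.inner_sum]
    push_cast
    exact Finset.sum_congr rfl fun k _ => RCLike.conj_mul _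
  rw [← hL2]
  refine pow_le_pow_left₀ (norm_nonneg _) (le_trans ?_ hfB) 2
  refine ((ContinuousMap.toLp (E := ℂ) 2 volume ℂ).le_opNorm f).trans ?_
  refine (mul_le_mul_of_nonneg_right (ContinuousMap.toLp_norm_le volume) (norm_nonneg f)).trans ?_
  rw [show measureUnivNNReal (volume : Measure (UnitAddTorus (Fin d))) = 1 by
    simp [measureUnivNNReal]]
  simp

end Bessel

/-- A lattice frequency as a vector of Euclidean space. -/
def freqVec (k : Fin d → ℤ) : EuclideanSpace ℝ (Fin d) := WithLp.toLp 2 fun i => (k i : ℝ)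

lemma norm_freqVec (k : Fin d → ℤ) : ‖freqVec k‖ = znorm k := by
  simp [freqVec, znorm, EuclideanSpace.norm_eq]

lemma fChar_sub_smul (k : Fin d → ℤ) (x : Fin d → ℝ) (r : ℝ) (y : EuclideanSpace ℝ (Fin d)) :
    fChar k (x - r • y.ofLp)
      = fChar k x * Complex.exp (((-2 * Real.pi * inner ℝ y (r • freqVec k) : ℝ) : ℂ) * I) := by
  rw [fChar, fChar, ← Complex.exp_add, ← add_mul, ← Complex.ofReal_add]
  congr 3
  simp only [freqVec, PiLp.inner_apply, Pi.sub_apply, Pi.smul_apply, smul_eq_mul, PiLp.smul_apply,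
    mul_sub, Finset.sum_sub_distrib, RCLike.inner_apply, conj_trivial]
  rw [Finset.mul_sum, Finset.mul_sum, Finset.mul_sum, ← sub_eq_zero]
  have : ∀ i, (k i : ℝ) * (r * y.ofLp i) = r * (k i : ℝ) * y.ofLp i := fun i => by ring
  simp only [this]
  rw [sub_add_eq_sub_sub, sub_sub_cancel_left, ← Finset.sum_neg_distrib, ← Finset.sum_sub_distrib]
  exact Finset.sum_eq_zero fun i _ => by ring

theorem exists_multiplier_bound (m : 𝓢(EuclideanSpace ℝ (Fin d), ℂ)) :
    ∃ C : ℝ, 0 ≤ C ∧ ∀ (r : ℝ) (a : (Fin d → ℤ) → ℂ), (support a).Finite → ∀ B : ℝ,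
      (∀ x, ‖realize a x‖ ≤ B) →
        ∀ x, ‖realize (fun k => m (r • freqVec k) * a k) x‖ ≤ C * B := by
  set K : 𝓢(EuclideanSpace ℝ (Fin d), ℂ) := 𝓕⁻ m with hK
  have hm : ∀ ξ, m ξ = ∫ y, Complex.exp (((-2 * Real.pi * inner ℝ y ξ : ℝ) : ℂ) * I) * K y := by
    intro ξ
    have h1 : 𝓕 K = m := by rw [hK]; exact FourierTransform.fourier_fourierInv_eq m
    rw [← h1, SchwartzMap.fourier_coe, Real.fourier_eq']
    simp only [smul_eq_mul]
  refine ⟨∫ y, ‖K y‖, integral_nonneg fun _ => norm_nonneg _, fun r a ha B hB x => ?_⟩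
  have hint : ∀ k, Integrable fun y : EuclideanSpace ℝ (Fin d) =>
      fChar k (x - r • y.ofLp) * a k * K y := by
    intro k
    refine K.integrable.bdd_mul (c := ‖a k‖) ?_ (Filter.Eventually.of_forall fun y => ?_)
    · exact (((continuous_fChar k).comp (by fun_prop)).mul continuous_const).aestronglyMeasurable
    · rw [norm_mul, norm_fChar, one_mul]
  have key : realize (fun k => m (r • freqVec k) * a k) x
      = ∫ y, realize a (x - r • y.ofLp) * K y := by
    rw [realize_eq_sum (s := ha.toFinset) (fun k hk => by
      simpa using right_ne_zero_of_mul hk)]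
    have : ∀ y : EuclideanSpace ℝ (Fin d), realize a (x - r • y.ofLp) * K y
        = ∑ k ∈ ha.toFinset, fChar k (x - r • y.ofLp) * a k * K y := by
      intro y
      rw [realize_eq_sum (s := ha.toFinset) (by simp), Finset.sum_mul]
      rfl
    simp only [this]
    rw [integral_finsetSum _ fun k _ => hint k]
    refine Finset.sum_congr rfl fun k _ => ?_
    rw [hm, smul_eq_mul, mul_comm _ (a k), ← mul_assoc, ← integral_const_mul]
    congr 1
    funext y
    rw [fChar_sub_smul]
    ring
  rw [key, ← integral_mul_const]
  refine norm_integral_le_of_norm_le (K.integrable.norm.mul_const B)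
    (Filter.Eventually.of_forall fun y => ?_)
  rw [norm_mul, mul_comm]
  exact mul_le_mul_of_nonneg_left (hB _) (norm_nonneg _)

lemma Cutoff.contDiff_radial (c : Cutoff) :
    ContDiff ℝ (⊤ : ℕ∞) fun ξ : EuclideanSpace ℝ (Fin d) => (c.χ ‖ξ‖ : ℂ) := by
  refine Complex.ofRealCLM.contDiff.comp (contDiff_iff_contDiffAt.2 fun ξ => ?_)
  rcases eq_or_ne ξ 0 with rfl | hξ
  · refine (contDiffAt_const (c := (1 : ℝ))).congr_of_eventuallyEq ?_
    filter_upwards [Metric.closedBall_mem_nhds (0 : EuclideanSpace ℝ (Fin d)) (half_pos one_pos)]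
      with η hη
    exact c.eq_one _ ⟨norm_nonneg _, by simpa using hη⟩
  · exact c.smooth.contDiffAt.comp ξ (contDiffAt_norm ℝ hξ)

lemma Cutoff.hasCompactSupport_radial (c : Cutoff) :
    HasCompactSupport fun ξ : EuclideanSpace ℝ (Fin d) => (c.χ ‖ξ‖ : ℂ) := by
  refine HasCompactSupport.of_support_subset_isCompact
    (isCompact_closedBall (0 : EuclideanSpace ℝ (Fin d)) 1) fun ξ hξ => ?_
  by_contra h
  rw [mem_closedBall_zero_iff, not_le] at h
  exact hξ (by simp [c.eq_zero _ h.le])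

/-- The radial cutoff as a Schwartz function. -/
def Cutoff.radial (c : Cutoff) (d : ℕ) : 𝓢(EuclideanSpace ℝ (Fin d), ℂ) :=
  c.hasCompactSupport_radial.toSchwartzMap c.contDiff_radial

/-- The radial cutoff times a coordinate, as a Schwartz function. -/
def Cutoff.coordRadial (c : Cutoff) (l : Fin d) : 𝓢(EuclideanSpace ℝ (Fin d), ℂ) :=
  HasCompactSupport.toSchwartzMap
    (f := fun ξ : EuclideanSpace ℝ (Fin d) => ((ξ l : ℝ) : ℂ) * (c.χ ‖ξ‖ : ℂ))
    c.hasCompactSupport_radial.mul_left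
    ((Complex.ofRealCLM.contDiff.comp (by fun_prop)).mul c.contDiff_radial)

lemma Cutoff.radial_apply (c : Cutoff) (ξ : EuclideanSpace ℝ (Fin d)) :
    c.radial d ξ = (c.χ ‖ξ‖ : ℂ) := rfl

lemma Cutoff.coordRadial_apply (c : Cutoff) (l : Fin d) (ξ : EuclideanSpace ℝ (Fin d)) :
    c.coordRadial l ξ = ((ξ l : ℝ) : ℂ) * (c.χ ‖ξ‖ : ℂ) := rfl

lemma norm_inv_pow_smul_freqVec (j : ℕ) (k : Fin d → ℤ) :
    ‖((2 : ℝ) ^ j)⁻¹ • freqVec k‖ = znorm k / 2 ^ j := by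
  rw [norm_smul, norm_freqVec, Real.norm_of_nonneg (by positivity), inv_mul_eq_div]

lemma realize_const_mul (z : ℂ) (a : (Fin d → ℤ) → ℂ) (x : Fin d → ℝ) :
    realize (fun k => z * a k) x = z * realize a x := by
  simp only [realize, smul_eq_mul, mul_left_comm _ z, tsum_mul_left]

lemma realize_finset_sum {ι : Type*} (s : Finset ι) {a : ι → (Fin d → ℤ) → ℂ}
    (h : ∀ i, (support (a i)).Finite) (x : Fin d → ℝ) :
    realize (fun k => ∑ i ∈ s, a i k) x = ∑ i ∈ s, realize (a i) x := by
  simp only [realize, Finset.smul_sum]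
  refine Summable.tsum_finsetSum fun i _ => summable_of_hasFiniteSupport ?_
  exact (h i).subset fun k hk => right_ne_zero_of_smul hk

lemma realize_sub {a b : (Fin d → ℤ) → ℂ} (ha : (support a).Finite) (hb : (support b).Finite)
    (x : Fin d → ℝ) : realize (fun k => a k - b k) x = realize a x - realize b x := by
  simp only [realize, smul_sub]
  refine Summable.tsum_sub (summable_of_hasFiniteSupport ?_) (summable_of_hasFiniteSupport ?_)
  · exact ha.subset fun k hk => right_ne_zero_of_smul hk
  · exact hb.subset fun k hk => right_ne_zero_of_smul hk

lemma support_mul_finite (f : (Fin d → ℤ) → ℂ) {a : (Fin d → ℤ) → ℂ} (h : (support a).Finite) :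
    (support fun k => f k * a k).Finite :=
  h.subset fun _ hk => right_ne_zero_of_mul hk

theorem exists_cutoff_bound (c : Cutoff) (d : ℕ) :
    ∃ C : ℝ, 0 ≤ C ∧ ∀ (j : ℕ) (a : (Fin d → ℤ) → ℂ), (support a).Finite → ∀ B : ℝ,
      (∀ x, ‖realize a x‖ ≤ B) → ∀ x,
        ‖realize (fun k => (c.χ (znorm k / 2 ^ j) : ℂ) * a k) x‖ ≤ C * B ∧
        ∀ l, ‖realize (fun k => (k l : ℂ) * ((c.χ (znorm k / 2 ^ j) : ℂ) * a k)) x‖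
          ≤ C * 2 ^ j * B := by
  obtain ⟨C₀, hC₀, h₀⟩ := exists_multiplier_bound (c.radial d)
  choose C₁ hC₁ h₁ using fun l : Fin d => exists_multiplier_bound (c.coordRadial l)
  refine ⟨C₀ + ∑ l, C₁ l, add_nonneg hC₀ (Finset.sum_nonneg fun l _ => hC₁ l),
    fun j a ha B hB x => ⟨?_, fun l => ?_⟩⟩
  · have hB0 : 0 ≤ B := (norm_nonneg _).trans (hB x)
    have h := h₀ ((2 : ℝ) ^ j)⁻¹ a ha B hB x
    simp only [Cutoff.radial_apply, norm_inv_pow_smul_freqVec] at h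
    refine h.trans (mul_le_mul_of_nonneg_right ?_ hB0)
    exact le_add_of_nonneg_right (Finset.sum_nonneg fun l _ => hC₁ l)
  · have hB0 : 0 ≤ B := (norm_nonneg _).trans (hB x)
    have h := h₁ l ((2 : ℝ) ^ j)⁻¹ a ha B hB x
    simp only [Cutoff.coordRadial_apply, norm_inv_pow_smul_freqVec] at h
    have heq : (fun k : Fin d → ℤ => (k l : ℂ) * ((c.χ (znorm k / 2 ^ j) : ℂ) * a k))
        = fun k => (2 : ℂ) ^ j * (((((2 : ℝ) ^ j)⁻¹ • freqVec k) l : ℝ)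
          * (c.χ (znorm k / 2 ^ j) : ℂ) * a k) := by
      funext k
      simp only [freqVec, PiLp.smul_apply, smul_eq_mul]
      push_cast
      field_simp
    have hle : C₁ l ≤ C₀ + ∑ l, C₁ l :=
      (Finset.single_le_sum (fun l _ => hC₁ l) (Finset.mem_univ l)).trans
        (le_add_of_nonneg_left hC₀)
    rw [heq, realize_const_mul, norm_mul, norm_pow, Complex.norm_ofNat]
    calc (2 : ℝ) ^ j * _ ≤ 2 ^ j * (C₁ l * B) := by gcongr
      _ ≤ 2 ^ j * ((C₀ + ∑ l, C₁ l) * B) := by gcongr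
      _ = _ := by ring

theorem exists_block_bound (c : Cutoff) (d : ℕ) :
    ∃ C : ℝ, 0 ≤ C ∧ ∀ (j : ℕ) (a : (Fin d → ℤ) → ℂ), (support a).Finite → ∀ B : ℝ,
      (∀ x, ‖realize a x‖ ≤ B) → ∀ x,
        ‖realize (fun k => (lpSymb c j (znorm k) : ℂ) * a k) x‖ ≤ C * B ∧
        (∀ l, ‖realize (fun k => (k l : ℂ) * ((lpSymb c j (znorm k) : ℂ) * a k)) x‖
          ≤ C * 2 ^ j * B) ∧
        ((∀ k, 2 ^ j ≤ znorm k → a k = 0) →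
          ∀ l, ‖realize (fun k => (k l : ℂ) * a k) x‖ ≤ C * 2 ^ j * B) := by
  obtain ⟨C, hC, h⟩ := exists_cutoff_bound c d
  refine ⟨2 * C, by positivity, fun j a ha B hB x => ?_⟩
  have hB0 : 0 ≤ B := (norm_nonneg _).trans (hB x)
  refine ⟨?_, fun l => ?_, fun hs l => ?_⟩
  · cases j with
    | zero =>
      have := (h 0 a ha B hB x).1
      simp only [pow_zero, div_one] at this
      refine this.trans ?_
      nlinarith [mul_nonneg hC hB0]
    | succ j =>
      have h1 := (h (j + 1) a ha B hB x).1
      have h2 := (h j a ha B hB x).1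
      simp only [lpSymb, Complex.ofReal_sub, sub_mul]
      rw [realize_sub (support_mul_finite _ ha) (support_mul_finite _ ha)]
      refine (norm_sub_le _ _).trans ?_
      linarith
  · cases j with
    | zero =>
      have := (h 0 a ha B hB x).2 l
      simp only [pow_zero, div_one] at this
      simp only [lpSymb, pow_zero]
      refine this.trans ?_
      nlinarith [mul_nonneg hC hB0]
    | succ j =>
      have h1 := (h (j + 1) a ha B hB x).2 l
      have h2 := (h j a ha B hB x).2 l
      simp only [lpSymb, Complex.ofReal_sub, sub_mul, mul_sub]
      rw [realize_sub (support_mul_finite _ (support_mul_finite _ ha))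
        (support_mul_finite _ (support_mul_finite _ ha))]
      refine (norm_sub_le _ _).trans ((add_le_add h1 h2).trans ?_)
      have : 0 ≤ C * 2 ^ j * B := by positivity
      rw [pow_succ]
      linarith
  · have h1 := (h (j + 1) a ha B hB x).2 l
    have heq : (fun k : Fin d → ℤ => (k l : ℂ) * ((c.χ (znorm k / 2 ^ (j + 1)) : ℂ) * a k))
        = fun k => (k l : ℂ) * a k := by
      funext k
      rcases le_or_gt (2 ^ j) (znorm k) with hk | hk
      · simp [hs k hk]
      · rw [c.eq_one, Complex.ofReal_one, one_mul]
        refine ⟨div_nonneg (Real.sqrt_nonneg _) (by positivity), ?_⟩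
        rw [div_le_iff₀ (by positivity), pow_succ]
        linarith
    rw [heq] at h1
    refine h1.trans (le_of_eq ?_)
    rw [pow_succ]
    ring

lemma znorm_nonneg (k : Fin d → ℤ) : 0 ≤ znorm k := Real.sqrt_nonneg _

lemma znorm_le_add_sub (k m : Fin d → ℤ) : znorm k ≤ znorm m + znorm (k - m) := by
  simp only [← norm_freqVec]
  refine le_trans (le_of_eq ?_) (norm_add_le (freqVec m) (freqVec (k - m)))
  congr 1
  ext i
  simp [freqVec]

lemma znorm_sub_comm (k m : Fin d → ℤ) : znorm (k - m) = znorm (m - k) := by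
  simp only [znorm, Pi.sub_apply, Int.cast_sub]
  congr 1
  exact Finset.sum_congr rfl fun i _ => by ring

lemma abs_le_znorm (k : Fin d → ℤ) (l : Fin d) : |(k l : ℝ)| ≤ znorm k := by
  rw [← norm_freqVec]
  simpa [freqVec] using PiLp.norm_apply_le (freqVec k) l

lemma finite_znorm_lt (d : ℕ) (R : ℝ) : {k : Fin d → ℤ | znorm k < R}.Finite := by
  refine (Set.Finite.pi' fun _ : Fin d => Set.finite_Icc (-⌈R⌉) ⌈R⌉).subset fun k hk l => ?_
  have h := abs_le.1 ((abs_le_znorm k l).trans ((le_of_lt hk).trans (Int.le_ceil R)))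
  exact ⟨by exact_mod_cast h.1, by exact_mod_cast h.2⟩

lemma lpSymb_eq_zero_of_le (c : Cutoff) {j : ℕ} {t : ℝ} (h : 2 ^ j ≤ t) : lpSymb c j t = 0 := by
  cases j with
  | zero => exact c.eq_zero _ (by simpa using h)
  | succ j =>
    have h' : (2 : ℝ) ^ j ≤ t :=
      (pow_le_pow_right₀ one_le_two j.le_succ).trans h
    rw [lpSymb, c.eq_zero _ ((one_le_div (by positivity)).2 h),
      c.eq_zero _ ((one_le_div (by positivity)).2 h'), sub_zero]

lemma lpSymb_eq_zero_of_four_mul_le (c : Cutoff) {j : ℕ} (hj : j ≠ 0) {t : ℝ} (ht : 0 ≤ t)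
    (h : 4 * t ≤ 2 ^ j) : lpSymb c j t = 0 := by
  obtain ⟨j, rfl⟩ := Nat.exists_eq_succ_of_ne_zero hj
  have h2 : (0 : ℝ) < 2 ^ j := by positivity
  rw [Nat.succ_eq_add_one, pow_succ] at h
  rw [lpSymb, c.eq_one, c.eq_one, sub_self]
  · exact ⟨by positivity, by rw [div_le_iff₀ h2]; linarith⟩
  · exact ⟨by positivity, by rw [div_le_iff₀ (by positivity), pow_succ]; linarith⟩

lemma lpSymb_nonneg (c : Cutoff) (j : ℕ) {t : ℝ} (ht : 0 ≤ t) : 0 ≤ lpSymb c j t := by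
  cases j with
  | zero => exact c.nonneg t
  | succ j =>
    refine sub_nonneg.2 (c.mono ?_ ?_ ?_)
    · exact div_nonneg ht (by positivity)
    · exact div_nonneg ht (by positivity)
    · gcongr
      · exact one_le_two
      · exact j.le_succ

lemma sum_range_lpSymb (c : Cutoff) (n : ℕ) (t : ℝ) :
    ∑ j ∈ Finset.range (n + 1), lpSymb c j t = c.χ (t / 2 ^ n) := by
  induction n with
  | zero => simp [lpSymb]
  | succ n ih => rw [Finset.sum_range_succ, ih, lpSymb]; ring

lemma hasSum_lpSymb (c : Cutoff) {t : ℝ} (ht : 0 ≤ t) : HasSum (fun j => lpSymb c j t) 1 := by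
  obtain ⟨n, hn⟩ := pow_unbounded_of_one_lt (2 * t) one_lt_two
  have h1 : ∑ j ∈ Finset.range (n + 1), lpSymb c j t = 1 := by
    rw [sum_range_lpSymb]
    exact c.eq_one _ ⟨by positivity, by rw [div_le_iff₀ (by positivity)]; linarith⟩
  rw [← h1]
  refine hasSum_sum_of_ne_finset_zero fun j hj => ?_
  obtain ⟨i, rfl⟩ : ∃ i, j = n + 1 + i := Nat.exists_eq_add_of_le (by simpa using hj)
  refine lpSymb_eq_zero_of_four_mul_le c (by omega) ht ?_
  have : (1 : ℝ) ≤ 2 ^ i := one_le_pow₀ one_le_two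
  rw [pow_add, pow_succ]
  nlinarith

lemma blockC_eq_zero [NormedAddCommGroup E] [NormedSpace ℂ E] (c : Cutoff) {j : ℕ}
    (a : (Fin d → ℤ) → E) {k : Fin d → ℤ} (hk : 2 ^ j ≤ znorm k) : blockC c j a k = 0 := by
  simp [blockC, lpSymb_eq_zero_of_le c hk]

lemma support_blockC_subset [NormedAddCommGroup E] [NormedSpace ℂ E] (c : Cutoff) (j : ℕ)
    (a : (Fin d → ℤ) → E) : support (blockC c j a) ⊆ {k | znorm k < 2 ^ j} := fun k hk => by
  by_contra h
  exact hk (blockC_eq_zero c a (not_lt.1 h))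

lemma support_blockC_finite [NormedAddCommGroup E] [NormedSpace ℂ E] (c : Cutoff) (j : ℕ)
    (a : (Fin d → ℤ) → E) : (support (blockC c j a)).Finite :=
  (finite_znorm_lt d _).subset (support_blockC_subset c j a)

lemma realize_shift (b : (Fin d → ℤ) → ℂ) (m : Fin d → ℤ) (x : Fin d → ℝ) :
    realize (fun k => b (k - m)) x = fChar m x * realize b x := by
  simp only [realize, smul_eq_mul]
  rw [← (Equiv.subRight m).tsum_eq fun k => fChar k x * b k, ← tsum_mul_left]
  refine tsum_congr fun k => ?_
  rw [Equiv.subRight_apply, ← mul_assoc, ← fChar_add_freq, add_sub_cancel]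

lemma support_mul_shift_finite (z : ℂ) {b : (Fin d → ℤ) → ℂ} (hb : (support b).Finite)
    (m : Fin d → ℤ) : (support fun k => z * b (k - m)).Finite :=
  (hb.preimage (sub_left_injective (b := m)).injOn).subset fun _ hk => right_ne_zero_of_mul hk

lemma tsum_conv_eq_sum {a : (Fin d → ℤ) → ℂ} (ha : (support a).Finite) (b : (Fin d → ℤ) → ℂ)
    (k : Fin d → ℤ) : ∑' m, a m * b (k - m) = ∑ m ∈ ha.toFinset, a m * b (k - m) :=
  tsum_eq_sum fun m hm => by simp [notMem_support.1 (by simpa using hm : m ∉ support a)]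

lemma support_conv_finite {a b : (Fin d → ℤ) → ℂ} (ha : (support a).Finite)
    (hb : (support b).Finite) : (support fun k => ∑' m, a m * b (k - m)).Finite := by
  simp only [tsum_conv_eq_sum ha]
  refine (ha.toFinset.finite_toSet.biUnion fun m _ =>
    support_mul_shift_finite (a m) hb m).subset fun k hk => ?_
  obtain ⟨m, hm, hk⟩ := Finset.exists_ne_zero_of_sum_ne_zero hk
  exact Set.mem_biUnion hm hk

lemma realize_conv {a b : (Fin d → ℤ) → ℂ} (ha : (support a).Finite) (hb : (support b).Finite)
    (x : Fin d → ℝ) :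
    realize (fun k => ∑' m, a m * b (k - m)) x = realize a x * realize b x := by
  simp only [tsum_conv_eq_sum ha]
  rw [realize_finset_sum _ fun m => support_mul_shift_finite (a m) hb m,
    realize_eq_sum (a := a) (s := ha.toFinset) (by simp), Finset.sum_mul]
  refine Finset.sum_congr rfl fun m _ => ?_
  rw [realize_const_mul, realize_shift, smul_eq_mul]
  ring

lemma support_apply_finite {a : VC d} (h : (support a).Finite) (i : Fin d) :
    (support fun k => a k i).Finite :=
  h.subset fun k hk hk' => hk (by simp [hk'])

lemma realize_apply {a : VC d} (h : (support a).Finite) (x : Fin d → ℝ) (i : Fin d) :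
    realize a x i = realize (fun k => a k i) x := by
  rw [realize_eq_sum (s := h.toFinset) (by simp), realize_eq_sum (s := h.toFinset)
    (fun k hk => by simpa using fun hk' => hk (by simp [hk']))]
  simp

lemma advect_eq_sum_conv {u : VC d} (hu : (support u).Finite) (v : VC d) (k : Fin d → ℤ)
    (i : Fin d) : advect u v k i = ∑ l, ∑' m, u m l *
      ((((2 * Real.pi : ℝ) : ℂ) * I) * ((((k - m) l : ℤ) : ℂ) * v (k - m) i)) := by
  rw [← Summable.tsum_finsetSum fun l _ => summable_of_hasFiniteSupport
    ((support_apply_finite hu l).subset fun m hm => left_ne_zero_of_mul hm)]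
  refine tsum_congr fun m => ?_
  rw [Finset.sum_mul]
  refine Finset.sum_congr rfl fun l _ => ?_
  rw [Pi.sub_apply]
  ring

lemma advect_eq_div {u : VC d} (hu : (support u).Finite) (hdiv : DivFree u) (v : VC d)
    (k : Fin d → ℤ) (i : Fin d) : advect u v k i =
      ∑ l, (((2 * Real.pi : ℝ) : ℂ) * I) * ((k l : ℂ) * ∑' m, u m l * v (k - m) i) := by
  simp only [← tsum_mul_left]
  rw [← Summable.tsum_finsetSum fun l _ => summable_of_hasFiniteSupport
    ((support_apply_finite hu l).subset fun m hm =>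
      left_ne_zero_of_mul (right_ne_zero_of_mul (right_ne_zero_of_mul hm)))]
  refine tsum_congr fun m => ?_
  have h : ∑ l, u m l * ((((2 * Real.pi : ℝ) : ℂ) * I) * ((k l - m l : ℤ) : ℂ))
      = ∑ l, (((2 * Real.pi : ℝ) : ℂ) * I) * ((k l : ℂ) * u m l) := by
    rw [← sub_zero (∑ l, (((2 * Real.pi : ℝ) : ℂ) * I) * ((k l : ℂ) * u m l)),
      ← mul_zero (((2 * Real.pi : ℝ) : ℂ) * I), ← hdiv m, Finset.mul_sum,
      ← Finset.sum_sub_distrib]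
    refine Finset.sum_congr rfl fun l _ => ?_
    push_cast
    ring
  rw [h, Finset.sum_mul]
  exact Finset.sum_congr rfl fun l _ => by ring

theorem exists_block_advect_bound (c : Cutoff) (d : ℕ) :
    ∃ K : ℝ, 0 ≤ K ∧ ∀ (j q : ℕ) (u v : VC d), (support u).Finite → DivFree u →
      (∀ k, 2 ^ q ≤ znorm k → v k = 0) → ∀ A B : ℝ,
      (∀ x, ‖realize u x‖ ≤ A) → (∀ x, ‖realize v x‖ ≤ B) → ∀ x,
        ‖realize (blockC c j (advect u v)) x‖ ≤ K * A * (2 ^ q * B) ∧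
        ‖realize (blockC c j (advect u v)) x‖ ≤ K * A * (2 ^ j * B) := by
  obtain ⟨C, hC, h⟩ := exists_block_bound c d
  refine ⟨C * (d * (2 * Real.pi * (C + 1))), by positivity,
    fun j q u v hu hdiv hv A B hA hB x => ?_⟩
  have hA0 : 0 ≤ A := (norm_nonneg _).trans (hA x)
  have hB0 : 0 ≤ B := (norm_nonneg _).trans (hB x)
  have hvf : (support v).Finite := (finite_znorm_lt d (2 ^ q)).subset fun k hk => by
    by_contra hk'
    exact hk (hv k (not_lt.1 hk'))
  have hul := fun l => support_apply_finite hu l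
  have hvi := fun i => support_apply_finite hvf i
  have hAl : ∀ l x, ‖realize (fun k => u k l) x‖ ≤ A := fun l x => by
    rw [← realize_apply hu]
    exact (norm_le_pi_norm _ l).trans (hA x)
  have hBi : ∀ i x, ‖realize (fun k => v k i) x‖ ≤ B := fun i x => by
    rw [← realize_apply hvf]
    exact (norm_le_pi_norm _ i).trans (hB x)
  have hτ : ‖((2 * Real.pi : ℝ) : ℂ) * I‖ = 2 * Real.pi := by
    rw [norm_mul, Complex.norm_I, mul_one, Complex.norm_real, Real.norm_of_nonneg (by positivity)]
  have hcomp : ∀ i, realize (blockC c j (advect u v)) x i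
      = realize (fun k => (lpSymb c j (znorm k) : ℂ) * advect u v k i) x := fun i =>
    realize_apply (support_blockC_finite c j _) x i
  have hK : ∀ D : ℝ, 0 ≤ D → 0 ≤ C * (d * (2 * Real.pi * (C + 1))) * A * (D * B) :=
    fun D hD => by positivity
  refine ⟨(pi_norm_le_iff_of_nonneg (hK _ (by positivity))).2 fun i => ?_,
    (pi_norm_le_iff_of_nonneg (hK _ (by positivity))).2 fun i => ?_⟩
  · rw [hcomp]
    have hgf : (support fun k : Fin d → ℤ => advect u v k i).Finite := by
      simp only [advect_eq_sum_conv hu v]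
      refine (Set.finite_iUnion fun l => support_conv_finite (hul l)
        (support_mul_finite (fun _ => ((2 * Real.pi : ℝ) : ℂ) * I)
          (support_mul_finite (fun k => (k l : ℂ)) (hvi i)))).subset fun k hk => ?_
      obtain ⟨l, -, hl⟩ := Finset.exists_ne_zero_of_sum_ne_zero hk
      exact Set.mem_iUnion.2 ⟨l, hl⟩
    have hbound : ∀ x, ‖realize (fun k => advect u v k i) x‖
        ≤ d * (2 * Real.pi * (C + 1)) * A * (2 ^ q * B) := by
      intro x
      simp only [advect_eq_sum_conv hu v]
      rw [realize_finset_sum Finset.univ fun l => support_conv_finite (hul l)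
        (support_mul_finite (fun _ => ((2 * Real.pi : ℝ) : ℂ) * I)
          (support_mul_finite (fun k => (k l : ℂ)) (hvi i)))]
      refine (norm_sum_le_of_le (Finset.univ : Finset (Fin d))
        (f := fun l => realize (fun k => ∑' m, u m l * ((((2 * Real.pi : ℝ) : ℂ) * I) *
          ((((k - m) l : ℤ) : ℂ) * v (k - m) i))) x)
        (n := fun _ => 2 * Real.pi * (C + 1) * A * (2 ^ q * B)) fun l _ => ?_).trans_eq ?_
      · rw [realize_conv (hul l) (support_mul_finite (fun _ => ((2 * Real.pi : ℝ) : ℂ) * I)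
          (support_mul_finite (fun k => (k l : ℂ)) (hvi i))), realize_const_mul, norm_mul,
          norm_mul, hτ]
        have h3 := (h q (fun k => v k i) (hvi i) B (hBi i) x).2.2
          (fun k hk => by simp [hv k hk]) l
        calc _ ≤ A * (2 * Real.pi * (C * 2 ^ q * B)) := by gcongr; exact hAl l x
          _ ≤ A * (2 * Real.pi * ((C + 1) * 2 ^ q * B)) := by gcongr; linarith
          _ = _ := by ring
      · rw [Finset.sum_const, Finset.card_univ, Fintype.card_fin, nsmul_eq_mul]
        ring
    refine (h j _ hgf _ hbound x).1.trans_eq ?_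
    ring
  · rw [hcomp]
    have heq : (fun k => (lpSymb c j (znorm k) : ℂ) * advect u v k i)
        = fun k => ∑ l, (((2 * Real.pi : ℝ) : ℂ) * I) * ((k l : ℂ) *
          ((lpSymb c j (znorm k) : ℂ) * ∑' m, u m l * v (k - m) i)) := by
      funext k
      rw [advect_eq_div hu hdiv, Finset.mul_sum]
      exact Finset.sum_congr rfl fun l _ => by ring
    have hcf := fun l => support_conv_finite (hul l) (hvi i)
    rw [heq, realize_finset_sum Finset.univ fun l => support_mul_finite
      (fun _ => ((2 * Real.pi : ℝ) : ℂ) * I) (support_mul_finite (fun k => (k l : ℂ))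
        (support_mul_finite (fun k => (lpSymb c j (znorm k) : ℂ)) (hcf l)))]
    refine (norm_sum_le_of_le (Finset.univ : Finset (Fin d))
      (n := fun _ => 2 * Real.pi * (C * 2 ^ j * (A * B))) fun l _ => ?_).trans ?_
    · rw [realize_const_mul, norm_mul, hτ]
      refine mul_le_mul_of_nonneg_left ((h j _ (hcf l) (A * B) (fun x => ?_) x).2.1 l)
        (by positivity)
      rw [realize_conv (hul l) (hvi i), norm_mul]
      exact mul_le_mul (hAl l x) (hBi i x) (norm_nonneg _) hA0
    · rw [Finset.sum_const, Finset.card_univ, Fintype.card_fin, nsmul_eq_mul]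
      have : 0 ≤ d * (2 * Real.pi * (C * 2 ^ j * (A * B))) := by positivity
      nlinarith [mul_nonneg hC this]

lemma DivFree.blockC {u : VC d} (h : DivFree u) (c : Cutoff) (j : ℕ) :
    DivFree (blockC c j u) := fun k => by
  have := h k
  simp only [_root_.blockC, Pi.smul_apply, smul_eq_mul, mul_left_comm _ ((_ : ℝ) : ℂ)]
  rw [← Finset.mul_sum, this, mul_zero]

lemma two_pow_lt_of_lpSymb_ne_zero (c : Cutoff) {j : ℕ} (hj : j ≠ 0) {t : ℝ} (ht : 0 ≤ t)
    (h : lpSymb c j t ≠ 0) : 2 ^ j < 4 * t := by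
  by_contra! h'
  exact h (lpSymb_eq_zero_of_four_mul_le c hj ht h')

/-- The weight, summable in `j`, of the interaction of the blocks `Δ_p u` and `Δ_q v` in
`Δ_j (u·∇v)`. -/
def interactionWeight (j p q : ℕ) : ℝ :=
  if q + 3 ≤ p then if p < j + 3 ∧ j < p + 3 then 1 else 0
  else if j < q + 5 then 2 ^ j / 2 ^ q else 0

lemma interactionWeight_nonneg (j p q : ℕ) : 0 ≤ interactionWeight j p q := by
  unfold interactionWeight
  split_ifs <;> positivity

lemma tsum_interactionWeight_le (p q : ℕ) :
    ∑' j, ENNReal.ofReal (interactionWeight j p q) ≤ 32 := by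
  by_cases hpq : q + 3 ≤ p
  · rw [tsum_eq_sum (s := Finset.Icc (p - 2) (p + 2)) fun j hj => by
      rw [Finset.mem_Icc] at hj
      rw [interactionWeight, if_pos hpq, if_neg (by omega), ENNReal.ofReal_zero]]
    refine (Finset.sum_le_card_nsmul _ _ 1 fun j _ => ?_).trans ?_
    · rw [interactionWeight, if_pos hpq]
      split_ifs <;> simp
    · rw [Nat.card_Icc, show p + 2 + 1 - (p - 2) = 5 by omega]
      norm_num
  · rw [tsum_eq_sum (s := Finset.range (q + 5)) fun j hj => by
      rw [Finset.mem_range] at hj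
      rw [interactionWeight, if_neg hpq, if_neg hj, ENNReal.ofReal_zero],
      ← ENNReal.ofReal_sum_of_nonneg fun j _ => interactionWeight_nonneg j p q]
    refine ENNReal.ofReal_le_of_le_toReal ?_
    have : ∑ j ∈ Finset.range (q + 5), interactionWeight j p q
        = (∑ j ∈ Finset.range (q + 5), (2 : ℝ) ^ j) / 2 ^ q := by
      rw [Finset.sum_div]
      refine Finset.sum_congr rfl fun j hj => ?_
      rw [interactionWeight, if_neg hpq, if_pos (Finset.mem_range.1 hj)]
    rw [this, geom_sum_eq (by norm_num), div_le_iff₀ (by positivity), pow_add,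
      ENNReal.toReal_ofNat]
    norm_num
    linarith

lemma lpSymb_interaction_eq_zero (c : Cutoff) {j p q : ℕ} (k m : Fin d → ℤ)
    (h : interactionWeight j p q = 0) (hj : lpSymb c j (znorm k) ≠ 0)
    (hp : lpSymb c p (znorm m) ≠ 0) : lpSymb c q (znorm (k - m)) = 0 := by
  by_contra hq
  have lt_of_ne : ∀ {i : ℕ} {t : ℝ}, lpSymb c i t ≠ 0 → t < 2 ^ i := fun hi => by
    by_contra! h'
    exact hi (lpSymb_eq_zero_of_le c h')
  have h1 := lt_of_ne hj
  have h2 := lt_of_ne hp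
  have h3 := lt_of_ne hq
  have hkm := znorm_le_add_sub k m
  have hmk := znorm_le_add_sub m k
  rw [znorm_sub_comm] at hmk
  have hmono : ∀ {a b : ℕ}, a ≤ b → (2 : ℝ) ^ a ≤ 2 ^ b := fun hab =>
    pow_le_pow_right₀ one_le_two hab
  have hpos : (0 : ℝ) < 2 ^ p := by positivity
  have hposq : (0 : ℝ) < 2 ^ q := by positivity
  unfold interactionWeight at h
  split_ifs at h with hpq hjp hjq
  · norm_num at h
  · have h4 := two_pow_lt_of_lpSymb_ne_zero c (by omega) (znorm_nonneg m) hp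
    have h5 := hmono hpq
    rw [pow_add] at h5
    rcases le_or_gt (j + 3) p with hle | hlt
    · have h6 := hmono hle
      rw [pow_add] at h6
      linarith
    · have hle : p + 3 ≤ j := by omega
      have h6 := hmono hle
      rw [pow_add] at h6
      have h7 := two_pow_lt_of_lpSymb_ne_zero c (by omega) (znorm_nonneg k) hj
      linarith
  · exact absurd h (by positivity)
  · have h5 := hmono (show p ≤ q + 2 by omega)
    have h6 := hmono (not_lt.1 hjq)
    have h7 := two_pow_lt_of_lpSymb_ne_zero c (by omega) (znorm_nonneg k) hj
    rw [pow_add] at h5 h6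
    linarith

lemma blockC_advect_blockC_eq_zero (c : Cutoff) {j p q : ℕ} (u v : VC d)
    (h : interactionWeight j p q = 0) :
    blockC c j (advect (blockC c p u) (blockC c q v)) = 0 := by
  funext k i
  by_cases hj : lpSymb c j (znorm k) = 0
  · simp [blockC, hj]
  · suffices h0 : advect (blockC c p u) (blockC c q v) k i = 0 by
      change ((lpSymb c j (znorm k) : ℝ) : ℂ) * advect (blockC c p u) (blockC c q v) k i = 0
      rw [h0, mul_zero]
    refine (tsum_congr fun m => ?_).trans tsum_zero
    by_cases hp : lpSymb c p (znorm m) = 0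
    · simp [blockC, hp]
    · simp [blockC, lpSymb_interaction_eq_zero c k m h hj hp]

theorem exists_interaction_bound (c : Cutoff) (d : ℕ) :
    ∃ K : ℝ, 0 ≤ K ∧ ∀ (j p q : ℕ) (u v : VC d), DivFree u → ∀ A B : ℝ,
      (∀ x, ‖realize (blockC c p u) x‖ ≤ A) → (∀ x, ‖realize (blockC c q v) x‖ ≤ B) → ∀ x,
        ‖realize (blockC c j (advect (blockC c p u) (blockC c q v))) x‖
          ≤ K * (A * (2 ^ q * B)) * interactionWeight j p q := by
  obtain ⟨K, hK, h⟩ := exists_block_advect_bound c d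
  refine ⟨K, hK, fun j p q u v hdiv A B hA hB x => ?_⟩
  by_cases hw : interactionWeight j p q = 0
  · rw [blockC_advect_blockC_eq_zero c u v hw, hw]
    simp [realize]
  · obtain ⟨h1, h2⟩ := h j q (blockC c p u) (blockC c q v) (support_blockC_finite c p u)
      (hdiv.blockC c p) (fun k hk => blockC_eq_zero c v hk) A B hA hB x
    unfold interactionWeight at hw ⊢
    split_ifs at hw ⊢
    · rw [mul_one]
      exact h1.trans_eq (by ring)
    · exact absurd rfl hw
    · refine h2.trans_eq ?_
      field_simp
    · exact absurd rfl hw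

lemma sum_sq_le_of_norm_realize_le_of_finite {a : (Fin d → ℤ) → ℂ} (h : (support a).Finite)
    (s : Finset (Fin d → ℤ)) {B : ℝ} (hB : ∀ x, ‖realize a x‖ ≤ B) :
    ∑ k ∈ s, ‖a k‖ ^ 2 ≤ B ^ 2 := by
  classical
  refine (Finset.sum_le_sum_of_subset_of_nonneg (Finset.subset_union_left (s₂ := h.toFinset))
    fun k _ _ => by positivity).trans (sum_sq_le_of_norm_realize_le (fun k hk => ?_) hB)
  simpa using Or.inr hk

lemma sum_norm_advect_term_le {q : ℕ} {u v : VC d} (hu : (support u).Finite)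
    (hv : ∀ k, 2 ^ q ≤ znorm k → v k = 0) {A B : ℝ} (hA : ∀ x, ‖realize u x‖ ≤ A)
    (hB : ∀ x, ‖realize v x‖ ≤ B) (k : Fin d → ℤ) (i : Fin d) (s : Finset (Fin d → ℤ)) :
    ∑ m ∈ s, ‖(∑ l, u m l * (((2 * Real.pi : ℝ) : ℂ) * I * ((k l - m l : ℤ) : ℂ)))
      * v (k - m) i‖ ≤ d * (2 * Real.pi) * (A * (2 ^ q * B)) := by
  classical
  have hA0 : 0 ≤ A := (norm_nonneg _).trans (hA 0)
  have hB0 : 0 ≤ B := (norm_nonneg _).trans (hB 0)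
  have hvf : (support v).Finite := (finite_znorm_lt d (2 ^ q)).subset fun k hk => by
    by_contra hk'
    exact hk (hv k (not_lt.1 hk'))
  have hterm : ∀ m, ‖(∑ l, u m l * (((2 * Real.pi : ℝ) : ℂ) * I * ((k l - m l : ℤ) : ℂ)))
      * v (k - m) i‖ ≤ ∑ l, 2 * Real.pi * 2 ^ q * (‖u m l‖ * ‖v (k - m) i‖) := by
    intro m
    rcases le_or_gt (2 ^ q) (znorm (k - m)) with hk | hk
    · simp [hv _ hk]
    · rw [norm_mul]
      refine (mul_le_mul_of_nonneg_right (norm_sum_le _ _) (norm_nonneg _)).trans ?_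
      rw [Finset.sum_mul]
      refine Finset.sum_le_sum fun l _ => ?_
      have hl : ‖((k l - m l : ℤ) : ℂ)‖ ≤ 2 ^ q := by
        rw [Complex.norm_intCast]
        exact (abs_le_znorm (k - m) l).trans hk.le
      rw [norm_mul, norm_mul, norm_mul, Complex.norm_I, mul_one, Complex.norm_real,
        Real.norm_of_nonneg (by positivity)]
      calc _ ≤ ‖u m l‖ * (2 * Real.pi * 2 ^ q) * ‖v (k - m) i‖ := by gcongr
        _ = _ := by ring
  have hcs : ∀ l, ∑ m ∈ s, ‖u m l‖ * ‖v (k - m) i‖ ≤ A * B := by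
    intro l
    have h1 : ∑ m ∈ s, ‖u m l‖ ^ 2 ≤ A ^ 2 :=
      sum_sq_le_of_norm_realize_le_of_finite (support_apply_finite hu l) s fun x => by
        rw [← realize_apply hu]
        exact (norm_le_pi_norm _ l).trans (hA x)
    have h2 : ∑ m ∈ s, ‖v (k - m) i‖ ^ 2 ≤ B ^ 2 := by
      rw [← Finset.sum_image (f := fun n => ‖v n i‖ ^ 2) (g := fun m => k - m)
        fun a _ b _ hab => sub_right_injective hab]
      exact sum_sq_le_of_norm_realize_le_of_finite (support_apply_finite hvf i) _ fun x => by
        rw [← realize_apply hvf]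
        exact (norm_le_pi_norm _ i).trans (hB x)
    refine (Real.sum_mul_le_sqrt_mul_sqrt s _ _).trans ?_
    exact mul_le_mul (Real.sqrt_le_iff.2 ⟨hA0, h1⟩) (Real.sqrt_le_iff.2 ⟨hB0, h2⟩)
      (Real.sqrt_nonneg _) hA0
  calc _ ≤ ∑ m ∈ s, ∑ l, 2 * Real.pi * 2 ^ q * (‖u m l‖ * ‖v (k - m) i‖) :=
        Finset.sum_le_sum fun m _ => hterm m
    _ = ∑ l, 2 * Real.pi * 2 ^ q * ∑ m ∈ s, ‖u m l‖ * ‖v (k - m) i‖ := by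
        rw [Finset.sum_comm]
        simp only [Finset.mul_sum]
    _ ≤ ∑ _l : Fin d, 2 * Real.pi * 2 ^ q * (A * B) := by gcongr with l; exact hcs l
    _ = _ := by
        rw [Finset.sum_const, Finset.card_univ, Fintype.card_fin, nsmul_eq_mul]
        ring

theorem hasSum_advect_blockC (c : Cutoff) {u v : VC d} {A B : ℕ → ℝ}
    (hA : ∀ p x, ‖realize (blockC c p u) x‖ ≤ A p)
    (hB : ∀ q x, ‖realize (blockC c q v) x‖ ≤ B q)
    (hAs : Summable A) (hBs : Summable fun q => 2 ^ q * B q) (k : Fin d → ℤ) (i : Fin d) :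
    HasSum (fun pq : ℕ × ℕ => advect (blockC c pq.1 u) (blockC c pq.2 v) k i)
      (advect u v k i) := by
  have hA0 : ∀ p, 0 ≤ A p := fun p => (norm_nonneg _).trans (hA p 0)
  have hB0 : ∀ q, 0 ≤ B q := fun q => (norm_nonneg _).trans (hB q 0)
  set G : (Fin d → ℤ) → ℂ := fun m =>
    (∑ l, u m l * (((2 * Real.pi : ℝ) : ℂ) * I * ((k l - m l : ℤ) : ℂ))) * v (k - m) i with hG
  set F : (ℕ × ℕ) × (Fin d → ℤ) → ℂ := fun z =>
    (lpSymb c z.1.1 (znorm z.2) * lpSymb c z.1.2 (znorm (k - z.2)) : ℝ) * G z.2 with hF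
  have hFeq : ∀ pq m, F (pq, m) = (∑ l, blockC c pq.1 u m l *
      (((2 * Real.pi : ℝ) : ℂ) * I * ((k l - m l : ℤ) : ℂ))) * blockC c pq.2 v (k - m) i := by
    intro pq m
    simp only [hF, hG, blockC, Pi.smul_apply, smul_eq_mul, mul_assoc]
    rw [← Finset.mul_sum]
    push_cast
    ring
  have hfin : ∀ pq, (support fun m => F (pq, m)).Finite := fun pq =>
    (finite_znorm_lt d (2 ^ pq.1)).subset fun m hm => by
      by_contra hm'
      exact hm (by simp [hF, lpSymb_eq_zero_of_le c (not_lt.1 hm')])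
  have hnfin : ∀ pq, (support fun m => ‖F (pq, m)‖).Finite := fun pq =>
    (hfin pq).subset fun m hm => norm_ne_zero_iff.1 hm
  have hFs : Summable F := by
    refine Summable.of_norm ((summable_prod_of_nonneg fun _ => norm_nonneg _).2
      ⟨fun pq => summable_of_hasFiniteSupport (hnfin pq), ?_⟩)
    refine Summable.of_nonneg_of_le (fun pq => tsum_nonneg fun _ => norm_nonneg _) (fun pq => ?_)
      ((hAs.mul_of_nonneg hBs hA0 fun q => mul_nonneg (by positivity) (hB0 q)).mul_left
        (d * (2 * Real.pi)))
    rw [tsum_eq_sum (s := (hnfin pq).toFinset) fun m hm => by simpa using hm]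
    simp only [hFeq]
    exact sum_norm_advect_term_le (support_blockC_finite c pq.1 u)
      (fun k hk => blockC_eq_zero c v hk) (hA pq.1) (hB pq.2) k i _
  have hblocks : HasSum (fun pq : ℕ × ℕ => advect (blockC c pq.1 u) (blockC c pq.2 v) k i)
      (∑' z, F z) := by
    refine hFs.hasSum.prod_fiberwise fun pq => ?_
    have : advect (blockC c pq.1 u) (blockC c pq.2 v) k i = ∑' m, F (pq, m) :=
      tsum_congr fun m => (hFeq pq m).symm
    rw [this]
    exact (summable_of_hasFiniteSupport (hfin pq)).hasSum
  have hfull : HasSum G (∑' z, F z) := by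
    have hswap := (Equiv.prodComm (Fin d → ℤ) (ℕ × ℕ)).hasSum_iff.2 hFs.hasSum
    refine hswap.prod_fiberwise fun m => ?_
    have h1 := hasSum_lpSymb c (znorm_nonneg m)
    have h2 := hasSum_lpSymb c (znorm_nonneg (k - m))
    have h3 := h1.mul h2 (h1.summable.mul_of_nonneg h2.summable
      (fun p => lpSymb_nonneg c p (znorm_nonneg m))
      (fun q => lpSymb_nonneg c q (znorm_nonneg (k - m))))
    have h4 := (Complex.hasSum_ofReal.2 h3).mul_right (G m)
    simpa [hF] using h4
  have : advect u v k i = ∑' z, F z := hfull.tsum_eq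
  rw [this]
  exact hblocks

lemma besov_top_one_eq [NormedAddCommGroup E] [NormedSpace ℂ E] (c : Cutoff) (s : ℝ)
    (a : (Fin d → ℤ) → E) :
    besov c s ∞ 1 a = ∑' j : ℕ, (2 : ℝ≥0∞) ^ ((j : ℝ) * s) * tLp ∞ (blockC c j a) := by
  simp [besov, lr]

lemma eq_zero_of_besov_eq_zero (c : Cutoff) (s : ℝ) {a : VC d} (h : besov c s ∞ 1 a = 0) :
    a = 0 := by
  rw [besov_top_one_eq, ENNReal.tsum_eq_zero] at h
  have hz : ∀ j k i, blockC c j a k i = 0 := by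
    intro j k i
    have hj : tLp ∞ (blockC c j a) = 0 :=
      (mul_eq_zero.1 (h j)).resolve_left (ENNReal.rpow_pos (by simp) (by simp)).ne'
    have hf := support_blockC_finite c j a
    have := sum_sq_le_of_norm_realize_le_of_finite (B := 0) (support_apply_finite hf i) {k}
      fun x => by
        have hx := enorm_realize_le_tLp hf x
        rw [hj, nonpos_iff_eq_zero, enorm_eq_zero] at hx
        rw [← realize_apply hf, hx]
        simp
    rw [Finset.sum_singleton, zero_pow two_ne_zero] at this
    exact norm_eq_zero.1 (pow_eq_zero_iff two_ne_zero |>.1 (le_antisymm this (by positivity)))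
  funext k i
  have h1 := (Complex.hasSum_ofReal.2 (hasSum_lpSymb c (znorm_nonneg k))).mul_right (a k i)
  have h2 : (fun j => (lpSymb c j (znorm k) : ℂ) * a k i) = fun _ => 0 :=
    funext fun j => hz j k i
  rw [h2, Complex.ofReal_one, one_mul] at h1
  exact h1.unique hasSum_zero

lemma besov_zero (c : Cutoff) (s : ℝ) : besov c s ∞ 1 (0 : VC d) = 0 := by
  rw [besov_top_one_eq, ENNReal.tsum_eq_zero]
  intro j
  have : realize (blockC c j (0 : VC d)) = 0 := by
    funext x
    simp [realize, blockC]
  rw [tLp, this, eLpNorm_zero, mul_zero]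

lemma besov_advect_le_of_ne_top (c : Cutoff) {K : ℝ} (hK : 0 ≤ K) {u v : VC d}
    (hbound : ∀ (j p q : ℕ), ∀ A B : ℝ,
      (∀ x, ‖realize (blockC c p u) x‖ ≤ A) → (∀ x, ‖realize (blockC c q v) x‖ ≤ B) → ∀ x,
        ‖realize (blockC c j (advect (blockC c p u) (blockC c q v))) x‖
          ≤ K * (A * (2 ^ q * B)) * interactionWeight j p q)
    (hu : besov c 0 ∞ 1 u ≠ ⊤) (hv : besov c 1 ∞ 1 v ≠ ⊤) :
    besov c 0 ∞ 1 (advect u v) ≤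
      32 * ENNReal.ofReal K * besov c 0 ∞ 1 u * besov c 1 ∞ 1 v := by
  simp only [besov_top_one_eq, mul_zero, ENNReal.rpow_zero, one_mul, mul_one,
    ENNReal.rpow_natCast] at hu hv ⊢
  have hut := ENNReal.ne_top_of_tsum_ne_top hu
  have hvt : ∀ q, tLp ∞ (blockC c q v) ≠ ⊤ := fun q hq =>
    ENNReal.ne_top_of_tsum_ne_top hv q (by rw [hq, ENNReal.mul_top (by simp)])
  set A : ℕ → ℝ := fun p => (tLp ∞ (blockC c p u)).toReal with hAdef
  set B : ℕ → ℝ := fun q => (tLp ∞ (blockC c q v)).toReal with hBdef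
  have norm_le : ∀ {w : VC d} {j : ℕ}, tLp ∞ (blockC c j w) ≠ ⊤ → ∀ x,
      ‖realize (blockC c j w) x‖ ≤ (tLp ∞ (blockC c j w)).toReal := fun {w j} hw x => by
    rw [← toReal_enorm]
    exact ENNReal.toReal_mono hw (enorm_realize_le_tLp (support_blockC_finite c j w) x)
  have hA : ∀ p x, ‖realize (blockC c p u) x‖ ≤ A p := fun p => norm_le (hut p)
  have hB : ∀ q x, ‖realize (blockC c q v) x‖ ≤ B q := fun q => norm_le (hvt q)
  have hAs : Summable A := ENNReal.summable_toReal hu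
  have hBs : Summable fun q => 2 ^ q * B q := by
    simpa [hBdef] using ENNReal.summable_toReal hv
  have hAB : ∀ p q, 0 ≤ A p * (2 ^ q * B q) := fun p q =>
    mul_nonneg ENNReal.toReal_nonneg (mul_nonneg (by positivity) ENNReal.toReal_nonneg)
  have hblock : ∀ j, tLp ∞ (blockC c j (advect u v)) ≤ ∑' pq : ℕ × ℕ,
      ENNReal.ofReal (K * (A pq.1 * (2 ^ pq.2 * B pq.2)) * interactionWeight j pq.1 pq.2) := by
    refine fun j => tLp_top_le fun x => ?_
    have hs : HasSum (fun pq : ℕ × ℕ =>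
        realize (blockC c j (advect (blockC c pq.1 u) (blockC c pq.2 v))) x)
        (realize (blockC c j (advect u v)) x) := by
      have hsupp : ∀ w : VC d, support (blockC c j w) ⊆ (finite_znorm_lt d (2 ^ j)).toFinset :=
        fun w => by simpa using support_blockC_subset c j w
      simp only [realize_eq_sum (hsupp _)]
      refine hasSum_sum fun k _ => HasSum.const_smul _ (HasSum.const_smul _ ?_)
      exact Pi.hasSum.2 fun i => hasSum_advect_blockC c hA hB hAs hBs k i
    rw [← hs.tsum_eq]
    refine enorm_tsum_le_tsum_enorm.trans (ENNReal.tsum_le_tsum fun pq => ?_)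
    rw [← ofReal_norm]
    exact ENNReal.ofReal_le_ofReal (hbound j pq.1 pq.2 _ _ (hA _) (hB _) x)
  calc ∑' j, tLp ∞ (blockC c j (advect u v))
      ≤ ∑' (j : ℕ) (pq : ℕ × ℕ), ENNReal.ofReal
        (K * (A pq.1 * (2 ^ pq.2 * B pq.2)) * interactionWeight j pq.1 pq.2) :=
        ENNReal.tsum_le_tsum hblock
    _ = ∑' pq : ℕ × ℕ, ENNReal.ofReal (K * (A pq.1 * (2 ^ pq.2 * B pq.2))) *
        ∑' j, ENNReal.ofReal (interactionWeight j pq.1 pq.2) := by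
        rw [ENNReal.tsum_comm]
        refine tsum_congr fun pq => ?_
        rw [← ENNReal.tsum_mul_left]
        exact tsum_congr fun j => ENNReal.ofReal_mul (mul_nonneg hK (hAB _ _))
    _ ≤ ∑' pq : ℕ × ℕ, 32 * ENNReal.ofReal K *
        (tLp ∞ (blockC c pq.1 u) * (2 ^ pq.2 * tLp ∞ (blockC c pq.2 v))) := by
        refine ENNReal.tsum_le_tsum fun pq => ?_
        refine (mul_le_mul_right (tsum_interactionWeight_le pq.1 pq.2) _).trans_eq ?_
        rw [ENNReal.ofReal_mul hK, ENNReal.ofReal_mul ENNReal.toReal_nonneg,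
          ENNReal.ofReal_mul (by positivity), ENNReal.ofReal_toReal (hut _),
          ENNReal.ofReal_toReal (hvt _), ENNReal.ofReal_pow (by norm_num), ENNReal.ofReal_ofNat]
        ring
    _ = _ := by
        rw [ENNReal.tsum_mul_left, ENNReal.tsum_prod
            (f := fun p q => tLp ∞ (blockC c p u) * (2 ^ q * tLp ∞ (blockC c q v))),
          mul_assoc (32 * ENNReal.ofReal K),
          ← ENNReal.tsum_mul_right]
        simp only [ENNReal.tsum_mul_left]

/-- **Product rule in `B^0_{∞,1}` with div-curl structure.**  There is a constant
`C > 0` such that for vector fields `u, v` on `𝕋^d` with `div u = 0`,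
`‖u·∇v‖_{B^0_{∞,1}} ≤ C ‖u‖_{B^0_{∞,1}} ‖v‖_{B^1_{∞,1}}`. -/
theorem product_rule_B01 (d : ℕ) (c : Cutoff) :
    ∃ C : ℝ≥0, 0 < C ∧
      ∀ u v : VC d, DivFree u →
        besov c 0 ∞ 1 (advect u v) ≤
          (C : ℝ≥0∞) * besov c 0 ∞ 1 u * besov c 1 ∞ 1 v := by
  obtain ⟨K, hK, hbound⟩ := exists_interaction_bound c d
  refine ⟨32 * K.toNNReal + 1, by positivity, fun u v hdiv => ?_⟩
  have hC : ((32 * K.toNNReal + 1 : ℝ≥0) : ℝ≥0∞) ≠ 0 := by simp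
  by_cases hu0 : besov c 0 ∞ 1 u = 0
  · have hadv : advect u v = 0 := by
      rw [eq_zero_of_besov_eq_zero c 0 hu0]
      funext k i
      simp [advect]
    rw [hadv, besov_zero]
    exact zero_le
  by_cases hv0 : besov c 1 ∞ 1 v = 0
  · have hadv : advect u v = 0 := by
      rw [eq_zero_of_besov_eq_zero c 1 hv0]
      funext k i
      simp [advect]
    rw [hadv, besov_zero]
    exact zero_le
  by_cases hu : besov c 0 ∞ 1 u = ⊤
  · rw [hu, ENNReal.mul_top hC, ENNReal.top_mul hv0]
    exact le_top
  by_cases hv : besov c 1 ∞ 1 v = ⊤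
  · rw [hv, ENNReal.mul_top (mul_ne_zero hC hu0)]
    exact le_top
  refine (besov_advect_le_of_ne_top c hK (fun j p q => hbound j p q u v hdiv) hu hv).trans ?_
  gcongr
  rw [ENNReal.coe_add, ENNReal.coe_mul]
  exact le_self_add
end
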